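/- Let A = I − E be a real d×d matrix, where |e_{ij}| ≤ ε for all 1 ≤ i, j ≤ d, e_{ii} = 0 for all 1 ≤ i ≤ d, and suppose (d−1)·ε ≤ 1. Then det(A) ≥ (1 − (d−1)·ε)·(1 + ε)^{d−1}. -/

import Mathlib

/-- Eliminating the first column of a matrix with nonzero top left entry expresses its determinant
through the Schur complement of that entry. -/
theorem Matrix.det_succ_eq_mul_det_schur {K : Type*} [Field K] {n : ℕ}
    (A : Matrix (Fin (n + 1)) (Fin (n + 1)) K) (h : A 0 0 ≠ 0) :
    A.det = A 0 0 * (Matrix.of fun i j : Fin n =>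
      A i.succ j.succ - A i.succ 0 * A 0 j.succ / A 0 0).det := by
  let c : Fin (n + 1) → K := Fin.cons 0 fun i => -(A i.succ 0 / A 0 0)
  let M : Matrix (Fin (n + 1)) (Fin (n + 1)) K := Matrix.of fun i j => A i j + c i * A 0 j
  have hM : M.det = A.det :=
    Matrix.det_eq_of_forall_row_eq_smul_add_const c 0 rfl fun _ _ => rfl
  have hcol (i : Fin n) : M i.succ 0 = 0 := by
    simp [M, c, h]
  rw [← hM, Matrix.det_succ_column_zero, Fin.sum_univ_succ]
  simp only [hcol, mul_zero, zero_mul, Finset.sum_const_zero, add_zero, Fin.val_zero, pow_zero,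
    one_mul]
  congr 1
  · simp [M, c]
  · congr 1
    ext i j
    simp [M, c]
    ring

/-- A matrix with diagonal entries at least `a` and off-diagonal entries of absolute value at most
`b` has determinant at least that of the matrix with diagonal entries `a` and off-diagonal entries
`-b`, provided the latter is weakly diagonally dominant. -/
theorem Matrix.le_det_of_le_diag_of_abs_off_diag_le {n : ℕ} {a b : ℝ} (hb : 0 ≤ b)
    (hab : n * b ≤ a) (A : Matrix (Fin (n + 1)) (Fin (n + 1)) ℝ) (hd : ∀ i, a ≤ A i i)
    (ho : ∀ i j, i ≠ j → |A i j| ≤ b) :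
    (a - n * b) * (a + b) ^ n ≤ A.det := by
  induction n generalizing a b with
  | zero => simpa using hd 0
  | succ n ih =>
    push_cast at hab ⊢
    have hnb : 0 ≤ n * b := by positivity
    rcases (show 0 ≤ a by linarith).eq_or_lt with rfl | ha
    · obtain rfl : b = 0 := by linarith
      have hA : A = Matrix.diagonal fun i => A i i := by
        ext i j
        rcases eq_or_ne i j with rfl | hij
        · simp
        · simpa [hij] using ho i j hij
      rw [hA, Matrix.det_diagonal]
      simpa using Finset.prod_nonneg fun i _ => hd i
    have hA : 0 < A 0 0 := ha.trans_le (hd 0)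
    have hquot (i j : Fin n.succ) : |A i.succ 0 * A 0 j.succ / A 0 0| ≤ b ^ 2 / a := by
      rw [abs_div, abs_mul, abs_of_pos hA, sq]
      gcongr
      · exact ho _ _ (Fin.succ_ne_zero i)
      · exact ho _ _ (Fin.succ_ne_zero j).symm
      · exact hd 0
    have hdom : (a - b ^ 2 / a) - n * (b + b ^ 2 / a) = (a + b) * (a - (n + 1) * b) / a := by
      field_simp
      ring
    have hnonneg : 0 ≤ (a + b) * (a - (n + 1) * b) / a :=
      div_nonneg (mul_nonneg (by linarith) (by linarith)) ha.le
    have key := ih (a := a - b ^ 2 / a) (b := b + b ^ 2 / a) (by positivity) (by linarith)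
      (Matrix.of fun i j => A i.succ j.succ - A i.succ 0 * A 0 j.succ / A 0 0)
      (fun i => by
        have h₁ := (abs_le.mp (hquot i i)).2
        have h₂ := hd i.succ
        simp only [Matrix.of_apply]
        linarith)
      (fun i j hij => (abs_sub _ _).trans
        (add_le_add (ho _ _ ((Fin.succ_injective _).ne hij)) (hquot i j)))
    rw [hdom, show a - b ^ 2 / a + (b + b ^ 2 / a) = a + b by ring] at key
    rw [A.det_succ_eq_mul_det_schur hA.ne']
    calc (a - (n + 1) * b) * (a + b) ^ (n + 1)
        = a * ((a + b) * (a - (n + 1) * b) / a * (a + b) ^ n) := by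
          field_simp
          ring
      _ ≤ A 0 0 * ((a + b) * (a - (n + 1) * b) / a * (a + b) ^ n) := by
          gcongr
          exact hd 0
      _ ≤ _ := by gcongr

theorem det_lower_bound_perturbed_identity_zero_diag (d : ℕ) (ε : ℝ)
    (E : Matrix (Fin d) (Fin d) ℝ) (hE : ∀ i j, |E i j| ≤ ε)
    (hdiag : ∀ i, E i i = 0)
    (hdε : ((d - 1 : ℕ) : ℝ) * ε ≤ 1) :
    (1 - E).det ≥ (1 - ((d - 1 : ℕ) : ℝ) * ε) * (1 + ε) ^ (d - 1) := by
  cases d with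
  | zero => simp
  | succ n =>
    rw [Nat.add_sub_cancel] at hdε ⊢
    exact Matrix.le_det_of_le_diag_of_abs_off_diag_le ((abs_nonneg _).trans (hE 0 0)) hdε (1 - E)
      (fun i => by simp [hdiag]) (fun i j hij => by simpa [hij] using hE i j)
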